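/- arXiv:1410.2028 — 2 statements merged into one kernel-verified Lean document; each statement's English description precedes it below -/
import Mathlib

section
/- If x < w in the Bruhat order on W, then ⟨x(ρ), ρ∨⟩ > ⟨w(ρ), ρ∨⟩. -/
/-!
Common framework: a Coxeter system `(W, S)` (encoded via Mathlib's
`CoxeterSystem`, with `S = {simple s : s ∈ B}`), the Bruhat order on `W`, and
a realisation `(𝔥, 𝔥*, {α_s}, {α_s^∨})` of `(W, S)` over `ℝ`.
-/

noncomputable section

variable {B : Type} {W : Type} [Group W] {M : CoxeterMatrix B}

/-- The strict Bruhat order on `W`: the transitive closure of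
`x < t x` whenever `t` is a reflection with `ℓ(x) < ℓ(t x)`. -/
def BruhatLT (cs : CoxeterSystem M W) : W → W → Prop :=
  Relation.TransGen fun x y =>
    ∃ t : W, cs.IsReflection t ∧ y = t * x ∧ cs.length x < cs.length y

/-- The Bruhat order on `W` (reflexive closure of `BruhatLT`). -/
def BruhatLE (cs : CoxeterSystem M W) : W → W → Prop :=
  Relation.ReflTransGen fun x y =>
    ∃ t : W, cs.IsReflection t ∧ y = t * x ∧ cs.length x < cs.length y

/-- A realisation of `(W, S)` over `ℝ`: a finite-dimensional real vector space
`𝔥 = V` with linearly independent simple roots `{α_s} ⊆ 𝔥*` and simple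
coroots `{α_s^∨} ⊆ 𝔥` satisfying `⟨α_s, α_t^∨⟩ = -2 cos (π / m_{s,t})`
(with `π/m = 0` when `m_{s,t} = ∞`, encoded by `M.M s t = 0`), together with
the (faithful) action of `W` on `𝔥` by `s · v = v - ⟨α_s, v⟩ α_s^∨`. -/
structure Realisation (cs : CoxeterSystem M W) (V : Type) [AddCommGroup V]
    [Module ℝ V] [FiniteDimensional ℝ V] : Type where
  α : B → Module.Dual ℝ V
  coα : B → V
  indep_α : LinearIndependent ℝ α
  indep_coα : LinearIndependent ℝ coα
  pairing : ∀ s t : B, α s (coα t) = -2 * Real.cos (Real.pi / (M.M s t))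
  act : W →* (V →ₗ[ℝ] V)
  act_simple : ∀ (s : B) (v : V), act (cs.simple s) v = v - α s v • coα s
  faithful : Function.Injective act

/-- `v` is a linear combination of the vectors `e i` with nonnegative coefficients. -/
def IsNonnegComb {E : Type} [AddCommGroup E] [Module ℝ E] (e : B → E) (v : E) : Prop :=
  ∃ c : B →₀ ℝ, (∀ i, 0 ≤ c i) ∧ Finsupp.linearCombination ℝ e c = v

namespace IsNonnegComb

variable {E : Type} [AddCommGroup E] [Module ℝ E] {e : B → E} {v v' : E}

theorem basis (e : B → E) (i : B) : IsNonnegComb e (e i) := by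
  classical
  refine ⟨Finsupp.single i 1, fun j => ?_, by simp⟩
  rw [Finsupp.single_apply]
  split_ifs <;> norm_num

theorem add (h : IsNonnegComb e v) (h' : IsNonnegComb e v') : IsNonnegComb e (v + v') := by
  obtain ⟨c, hc, rfl⟩ := h
  obtain ⟨c', hc', rfl⟩ := h'
  exact ⟨c + c', fun i => add_nonneg (hc i) (hc' i), by simp⟩

theorem smul (h : IsNonnegComb e v) {a : ℝ} (ha : 0 ≤ a) : IsNonnegComb e (a • v) := by
  obtain ⟨c, hc, rfl⟩ := h
  exact ⟨a • c, fun i => mul_nonneg ha (hc i), by simp⟩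

theorem apply_pos (h : IsNonnegComb e v) (hv : v ≠ 0) (f : Module.Dual ℝ E)
    (hf : ∀ i, 0 < f (e i)) : 0 < f v := by
  obtain ⟨c, hc, rfl⟩ := h
  have hc0 : c.support.Nonempty := by
    rw [Finsupp.support_nonempty_iff]
    rintro rfl
    simp at hv
  rw [Finsupp.apply_linearCombination, Finsupp.linearCombination_apply, Finsupp.sum]
  refine Finset.sum_pos (fun i hi => ?_) hc0
  exact mul_pos (lt_of_le_of_ne (hc i) (Finsupp.mem_support_iff.mp hi).symm) (hf i)

/-- If a nonnegative combination becomes nonpositive after subtracting a multiple of `e i`,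
then it is itself a multiple of `e i`. -/
theorem eq_smul (he : LinearIndependent ℝ e) (h : IsNonnegComb e v) {i : B} {d : ℝ}
    (h' : IsNonnegComb e (-(v - d • e i))) : ∃ a : ℝ, v = a • e i := by
  classical
  obtain ⟨c, hc, rfl⟩ := h
  obtain ⟨c', hc', h'⟩ := h'
  have hsum : c + c' = Finsupp.single i d := by
    apply he
    rw [map_add, h', Finsupp.linearCombination_single]
    abel
  refine ⟨c i, ?_⟩
  have hci : c = Finsupp.single i (c i) := by
    ext j
    by_cases hij : i = j
    · subst hij; simp
    · have hj := DFunLike.congr_fun hsum j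
      simp only [Finsupp.add_apply, Finsupp.single_apply, if_neg hij] at hj ⊢
      linarith [hc j, hc' j]
  conv_lhs => rw [hci]
  rw [Finsupp.linearCombination_single]

end IsNonnegComb

/-- The values `sin (k π / m) / sin (π / m)`, with the limiting value `k` for `m = 0`, which
stands for an infinite bond. -/
def dihedralCoeff (m k : ℕ) : ℝ :=
  if m = 0 then k else Real.sin (k * (Real.pi / m)) / Real.sin (Real.pi / m)

theorem sin_pi_div_pos {m : ℕ} (h0 : m ≠ 0) (h1 : m ≠ 1) : 0 < Real.sin (Real.pi / m) := by
  have h2 : (2 : ℝ) ≤ m := by exact_mod_cast (show 2 ≤ m by omega)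
  have := Real.pi_pos
  refine Real.sin_pos_of_pos_of_lt_pi (by positivity) ?_
  rw [div_lt_iff₀ (by linarith)]
  nlinarith

theorem dihedralCoeff_zero (m : ℕ) : dihedralCoeff m 0 = 0 := by
  simp [dihedralCoeff]

theorem dihedralCoeff_one {m : ℕ} (h1 : m ≠ 1) : dihedralCoeff m 1 = 1 := by
  unfold dihedralCoeff
  split_ifs with h0
  · simp
  · rw [Nat.cast_one, one_mul, div_self (sin_pi_div_pos h0 h1).ne']

theorem dihedralCoeff_add_two (m k : ℕ) :
    dihedralCoeff m (k + 2) =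
      2 * Real.cos (Real.pi / m) * dihedralCoeff m (k + 1) - dihedralCoeff m k := by
  unfold dihedralCoeff
  split_ifs with h0
  · subst h0
    simp
    ring
  · have h : ∀ θ : ℝ, Real.sin (((k + 2 : ℕ) : ℝ) * θ) =
        2 * Real.cos θ * Real.sin (((k + 1 : ℕ) : ℝ) * θ) - Real.sin (k * θ) := by
      intro θ
      have h2 : ((k + 2 : ℕ) : ℝ) * θ = ((k + 1 : ℕ) : ℝ) * θ + θ := by push_cast; ring
      have h3 : (k : ℝ) * θ = ((k + 1 : ℕ) : ℝ) * θ - θ := by push_cast; ring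
      rw [h2, h3, Real.sin_add, Real.sin_sub]
      ring
    rw [h]
    ring

theorem dihedralCoeff_nonneg {m k : ℕ} (h1 : m ≠ 1) (hk : m ≠ 0 → k ≤ m) :
    0 ≤ dihedralCoeff m k := by
  unfold dihedralCoeff
  split_ifs with h0
  · positivity
  · have hm : (0 : ℝ) < m := by positivity
    have hkm : (k : ℝ) ≤ m := by exact_mod_cast hk h0
    have := Real.pi_pos
    refine div_nonneg (Real.sin_nonneg_of_nonneg_of_le_pi (by positivity) ?_)
      (sin_pi_div_pos h0 h1).le
    rw [← mul_div_assoc, div_le_iff₀ hm]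
    nlinarith

namespace CoxeterSystem

section RootAction

variable (cs : CoxeterSystem M W) {E : Type} [AddCommGroup E] [Module ℝ E]
  (act : W →* Module.End ℝ E) (e : B → E)

/-- `e` is a family of simple roots for the action `act` of `W`. -/
def IsRootAction : Prop :=
  ∀ i j, act (cs.simple i) (e j) = e j + (2 * Real.cos (Real.pi / M i j)) • e i

variable {act e}

namespace IsRootAction

variable {cs}

theorem simple_self (h : cs.IsRootAction act e) (i : B) : act (cs.simple i) (e i) = -e i := by
  rw [h i i, M.diagonal i]
  norm_num
  module

theorem apply_mul_simple (h : cs.IsRootAction act e) (w : W) (i : B) :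
    act (w * cs.simple i) (e i) = -act w (e i) := by
  rw [map_mul, Module.End.mul_apply, h.simple_self, map_neg]

theorem alternatingWord_apply (h : cs.IsRootAction act e) {s t : B} (hst : s ≠ t) (k : ℕ) :
    act (cs.wordProd (alternatingWord s t k)) (e s) =
      dihedralCoeff (M s t) (k + 1) • e (if Even k then s else t) +
      dihedralCoeff (M s t) k • e (if Even k then t else s) := by
  induction k with
  | zero =>
    simp [alternatingWord, dihedralCoeff_zero, dihedralCoeff_one (M.off_diagonal s t hst)]
  | succ k ih =>
    rw [alternatingWord_succ', wordProd_cons, map_mul, Module.End.mul_apply, ih,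
      dihedralCoeff_add_two]
    by_cases hk : Even k
    · have hk' : ¬ Even (k + 1) := by simpa [parity_simps] using hk
      simp only [hk, hk', if_true, if_false, map_add, map_smul, h.simple_self, h t s,
        M.symmetric t s]
      module
    · have hk' : Even (k + 1) := by simpa [parity_simps] using hk
      simp only [hk, hk', if_true, if_false, map_add, map_smul, h.simple_self, h s t]
      module

end IsRootAction

theorem exists_mul_alternatingWord (s t : B) (m j : ℕ) :
    ∃ q, cs.wordProd (alternatingWord s t (m + j)) = q * cs.wordProd (alternatingWord s t m) ∧
      cs.length q ≤ j := by
  induction j with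
  | zero => exact ⟨1, by simp⟩
  | succ j ih =>
    obtain ⟨q, hq, hl⟩ := ih
    refine ⟨cs.simple (if Even (m + j) then t else s) * q, ?_, ?_⟩
    · rw [← add_assoc, alternatingWord_succ', wordProd_cons, hq, mul_assoc]
    · refine (cs.length_mul_le _ _).trans ?_
      rw [cs.length_simple]
      omega

/-- An alternating word longer than the order of the bond can be shortened by two letters. -/
theorem length_alternatingWord_add_two_le (s t : B) (hM : M s t ≠ 0) {k : ℕ} (hk : M s t < k) :
    cs.length (cs.wordProd (alternatingWord s t k)) + 2 ≤ k := by
  obtain ⟨j, rfl⟩ := Nat.exists_eq_add_of_lt hk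
  obtain ⟨q, hq, hl⟩ := cs.exists_mul_alternatingWord s t (M s t + 1) j
  rw [show M s t + j + 1 = M s t + 1 + j by omega, hq,
    cs.prod_alternatingWord_eq_prod_alternatingWord_sub s t (M s t + 1) (by omega)]
  have h1 := cs.length_mul_le q
    (cs.wordProd (alternatingWord t s (M s t * 2 - (M s t + 1))))
  have h2 := cs.length_wordProd_le (alternatingWord t s (M s t * 2 - (M s t + 1)))
  rw [length_alternatingWord] at h2
  omega

/-- Splitting off a maximal alternating right factor: if `t` is a right descent of `w`, then
`w = v * u` reduced with `u` a nonempty alternating product in `s`, `t`, such that neither `s` nor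
`t` is a right descent of `v`. -/
theorem exists_eq_mul_alternatingWord (w : W) (s t : B) (ht : cs.IsRightDescent w t) :
    ∃ v k, 0 < k ∧ w = v * cs.wordProd (alternatingWord s t k) ∧
      cs.length w = cs.length v + k ∧ ¬ cs.IsRightDescent v s ∧ ¬ cs.IsRightDescent v t := by
  classical
  let P : ℕ → Prop := fun k => ∃ v, w = v * cs.wordProd (alternatingWord s t k) ∧
      cs.length w = cs.length v + k
  have hP1 : P 1 := by
    refine ⟨w * cs.simple t, ?_, ?_⟩
    · simp [alternatingWord]
    · exact (cs.isRightDescent_iff.mp ht).symm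
  have hle : ∀ k, P k → k ≤ cs.length w := by
    rintro k ⟨v, -, hv⟩
    omega
  have hk1 := Nat.le_findGreatest (hle 1 hP1) hP1
  have hPk : P (Nat.findGreatest P (cs.length w)) := Nat.findGreatest_spec (hle 1 hP1) hP1
  have hmax : ¬ P (Nat.findGreatest P (cs.length w) + 1) := fun h =>
    Nat.findGreatest_is_greatest (Nat.lt_succ_self _) (hle _ h) h
  generalize Nat.findGreatest P (cs.length w) = k at hk1 hPk hmax
  obtain ⟨v, hw, hl⟩ := hPk
  have hnext : ¬ cs.IsRightDescent v (if Even k then t else s) := by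
    intro hd
    refine hmax ⟨v * cs.simple (if Even k then t else s), ?_, ?_⟩
    · rw [alternatingWord_succ', wordProd_cons, ← mul_assoc, simple_mul_simple_cancel_right, hw]
    · have := cs.isRightDescent_iff.mp hd
      omega
  have hprev : ¬ cs.IsRightDescent v (if Even k then s else t) := by
    intro hd
    obtain ⟨j, rfl⟩ := Nat.exists_eq_add_of_le' hk1
    have hj : (if Even (j + 1) then s else t) = if Even j then t else s := by
      by_cases h : Even j <;> simp [h, parity_simps]
    rw [hj] at hd
    rw [alternatingWord_succ', wordProd_cons, ← mul_assoc] at hw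
    have h1 := cs.length_mul_le (v * cs.simple (if Even j then t else s))
      (cs.wordProd (alternatingWord s t j))
    have h2 := cs.length_wordProd_le (alternatingWord s t j)
    have h3 := cs.isRightDescent_iff.mp hd
    rw [← hw] at h1
    rw [length_alternatingWord] at h2
    omega
  refine ⟨v, k, hk1, hw, hl, ?_⟩
  by_cases h : Even k
  · simp only [h, if_true] at hnext hprev
    exact ⟨hprev, hnext⟩
  · simp only [h, if_false] at hnext hprev
    exact ⟨hnext, hprev⟩

namespace IsRootAction

variable {cs}

/-- If `s` is not a right descent of `w`, then `w` sends the simple root of `s` to a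
nonnegative combination of simple roots. -/
theorem isNonnegComb_of_not_isRightDescent (h : cs.IsRootAction act e) (w : W) (s : B)
    (hs : ¬ cs.IsRightDescent w s) : IsNonnegComb e (act w (e s)) := by
  induction hn : cs.length w using Nat.strong_induction_on generalizing w s with
  | _ n ih =>
    subst hn
    by_cases hw1 : w = 1
    · subst hw1
      simpa using IsNonnegComb.basis e s
    obtain ⟨t, ht⟩ := cs.exists_rightDescent_of_ne_one hw1
    have hst : s ≠ t := by
      rintro rfl
      exact hs ht
    obtain ⟨v, k, hk, hw, hl, hvs, hvt⟩ := cs.exists_eq_mul_alternatingWord w s t ht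
    have hs' : IsNonnegComb e (act v (e s)) := ih _ (by omega) v s hvs rfl
    have ht' : IsNonnegComb e (act v (e t)) := ih _ (by omega) v t hvt rfl
    have hkm : M s t ≠ 0 → k + 1 ≤ M s t := by
      intro hM
      by_contra! hlt
      have h1 := cs.length_alternatingWord_add_two_le t s (M.symmetric t s ▸ hM)
        (k := k + 1) (by rwa [M.symmetric t s])
      have h2 : w * cs.simple s = v * cs.wordProd (alternatingWord t s (k + 1)) := by
        rw [alternatingWord_succ, List.concat_eq_append, wordProd_append, wordProd_singleton, hw,
          mul_assoc]
      have h3 := cs.length_mul_le v (cs.wordProd (alternatingWord t s (k + 1)))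
      have h4 := cs.not_isRightDescent_iff.mp hs
      rw [← h2] at h3
      omega
    have hM1 := M.off_diagonal s t hst
    have ha := dihedralCoeff_nonneg hM1 hkm
    have hb := dihedralCoeff_nonneg hM1 fun hM => (Nat.le_succ k).trans (hkm hM)
    rw [hw, map_mul, Module.End.mul_apply, h.alternatingWord_apply hst, map_add, map_smul, map_smul]
    by_cases hk : Even k
    · simpa only [hk, if_true] using (hs'.smul ha).add (ht'.smul hb)
    · simpa only [hk, if_false] using (ht'.smul ha).add (hs'.smul hb)

theorem isNonnegComb_neg_of_isRightDescent (h : cs.IsRootAction act e) (w : W) (s : B)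
    (hs : cs.IsRightDescent w s) : IsNonnegComb e (-act w (e s)) := by
  rw [← h.apply_mul_simple]
  exact h.isNonnegComb_of_not_isRightDescent _ s
    (cs.isRightDescent_iff_not_isRightDescent_mul.mp hs)

theorem apply_pos (h : cs.IsRootAction act e) (w : W) (s : B) (hs : ¬ cs.IsRightDescent w s)
    (f : Module.Dual ℝ E) (hf : ∀ i, 0 < f (e i)) : 0 < f (act w (e s)) := by
  refine (h.isNonnegComb_of_not_isRightDescent w s hs).apply_pos (fun h0 => ?_) f hf
  have h1 : act w⁻¹ (act w (e s)) = e s := by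
    rw [← Module.End.mul_apply, ← map_mul, inv_mul_cancel, map_one, Module.End.one_apply]
  rw [h0, map_zero] at h1
  simpa [← h1] using hf s

end IsRootAction

end RootAction

end CoxeterSystem

namespace Realisation

variable {cs : CoxeterSystem M W} {V : Type} [AddCommGroup V] [Module ℝ V]
  [FiniteDimensional ℝ V] (r : Realisation cs V)

/-- The contragredient action of `W` on the dual space. -/
def dualAct : W →* Module.End ℝ (Module.Dual ℝ V) where
  toFun w := (r.act w⁻¹).dualMap
  map_one' := by
    ext f v
    simp
  map_mul' x y := by
    ext f v
    simp

theorem dualAct_apply (w : W) (f : Module.Dual ℝ V) (v : V) :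
    r.dualAct w f v = f (r.act w⁻¹ v) := rfl

theorem act_mul_apply (x y : W) (v : V) : r.act (x * y) v = r.act x (r.act y v) := by
  rw [map_mul, Module.End.mul_apply]

theorem act_inv_apply_act (x : W) (v : V) : r.act x⁻¹ (r.act x v) = v := by
  rw [← act_mul_apply, inv_mul_cancel, map_one, Module.End.one_apply]

theorem act_apply_act_inv (x : W) (v : V) : r.act x (r.act x⁻¹ v) = v := by
  rw [← act_mul_apply, mul_inv_cancel, map_one, Module.End.one_apply]

theorem isRootAction : cs.IsRootAction r.act r.coα := by
  intro i j
  rw [r.act_simple, r.pairing]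
  module

theorem dualAct_simple (i : B) (f : Module.Dual ℝ V) :
    r.dualAct (cs.simple i) f = f - f (r.coα i) • r.α i := by
  ext v
  rw [dualAct_apply, cs.inv_simple, r.act_simple]
  simp [mul_comm]

theorem isRootAction_dual : cs.IsRootAction r.dualAct r.α := by
  intro i j
  rw [dualAct_simple, r.pairing, ← M.symmetric i j]
  module

theorem α_self (i : B) : r.α i (r.coα i) = 2 := by
  rw [r.pairing, M.diagonal i]
  norm_num

theorem dualAct_act (u : W) (f : Module.Dual ℝ V) (v : V) :
    r.dualAct u f (r.act u v) = f v := by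
  rw [dualAct_apply, act_inv_apply_act]

/-- Conjugates of simple reflections act by reflections. -/
theorem act_conj (u : W) (s : B) (v : V) :
    r.act (u * cs.simple s * u⁻¹) v =
      v - r.dualAct u (r.α s) v • r.act u (r.coα s) := by
  rw [act_mul_apply, act_mul_apply, r.act_simple, map_sub, map_smul, act_apply_act_inv,
    dualAct_apply]

/-- A simple reflection making a positive root negative is the reflection in that root. -/
theorem conj_eq_simple (r : Realisation cs V) (u : W) (s i : B) (h : ¬ cs.IsRightDescent u s)
    (h' : cs.IsRightDescent (cs.simple i * u) s) :
    u * cs.simple s * u⁻¹ = cs.simple i := by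
  obtain ⟨a, ha⟩ : ∃ a : ℝ, r.act u (r.coα s) = a • r.coα i := by
    have h2 := r.isRootAction.isNonnegComb_neg_of_isRightDescent _ s h'
    rw [act_mul_apply, r.act_simple] at h2
    exact (r.isRootAction.isNonnegComb_of_not_isRightDescent u s h).eq_smul r.indep_coα h2
  obtain ⟨b, hb⟩ : ∃ b : ℝ, r.dualAct u (r.α s) = b • r.α i := by
    have h2 := r.isRootAction_dual.isNonnegComb_neg_of_isRightDescent _ s h'
    rw [map_mul, Module.End.mul_apply, dualAct_simple] at h2
    exact (r.isRootAction_dual.isNonnegComb_of_not_isRightDescent u s h).eq_smul r.indep_α h2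
  have hab : b * a = 1 := by
    have h2 := r.dualAct_act u (r.α s) (r.coα s)
    rw [ha, hb, LinearMap.smul_apply, map_smul, r.α_self, r.α_self] at h2
    simp only [smul_eq_mul] at h2
    linarith
  apply r.faithful
  ext v
  rw [act_conj, ha, hb, r.act_simple, LinearMap.smul_apply, smul_smul, smul_eq_mul,
    mul_right_comm, hab, one_mul]

/-- If `x⁻¹` makes the positive root `u α_s` negative, then the reflection in that root
shortens `x`. -/
theorem length_conj_mul_lt (r : Realisation cs V) (x u : W) (s : B)
    (h : ¬ cs.IsRightDescent u s)
    (h' : cs.IsRightDescent (x⁻¹ * u) s) :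
    cs.length (u * cs.simple s * u⁻¹ * x) < cs.length x := by
  induction hn : cs.length x generalizing x u with
  | zero =>
    rw [cs.length_eq_zero_iff] at hn
    subst hn
    simp at h'
    exact absurd h' h
  | succ n ih =>
    obtain ⟨i, hi⟩ := cs.exists_leftDescent_of_ne_one (w := x) (by
      rintro rfl
      simp at hn)
    have hy := cs.isLeftDescent_iff.mp hi
    by_cases hd : cs.IsRightDescent (cs.simple i * u) s
    · rw [r.conj_eq_simple u s i h hd]
      omega
    · have := ih (cs.simple i * x) (cs.simple i * u) hd
        (by simpa [mul_assoc] using h') (by omega)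
      have h1 : cs.simple i * u * cs.simple s * (cs.simple i * u)⁻¹ * (cs.simple i * x) =
          cs.simple i * (u * cs.simple s * u⁻¹ * x) := by
        group
      rw [h1] at this
      have h2 := cs.length_simple_mul (u * cs.simple s * u⁻¹ * x) i
      omega

theorem lt_of_reflection {ρ : Module.Dual ℝ V} (hρ : ∀ s : B, 0 < ρ (r.coα s))
    {ρv : V} (hρv : ∀ s : B, 0 < r.α s ρv) {x t : W} (ht : cs.IsReflection t)
    (hlt : cs.length x < cs.length (t * x)) :
    ρ (r.act (t * x)⁻¹ ρv) < ρ (r.act x⁻¹ ρv) := by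
  obtain ⟨u, s, hu, rfl⟩ : ∃ u s, ¬ cs.IsRightDescent u s ∧ t = u * cs.simple s * u⁻¹ := by
    obtain ⟨u, s, rfl⟩ := ht
    by_cases hu : cs.IsRightDescent u s
    · refine ⟨u * cs.simple s, s, cs.isRightDescent_iff_not_isRightDescent_mul.mp hu, ?_⟩
      simp [mul_assoc]
    · exact ⟨u, s, hu, rfl⟩
  have hxu : ¬ cs.IsRightDescent (x⁻¹ * u) s := fun h' =>
    absurd (r.length_conj_mul_lt x u s hu h') (by omega)
  have hβ : 0 < r.dualAct u (r.α s) ρv :=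
    r.isRootAction_dual.apply_pos u s hu (Module.Dual.eval ℝ V ρv) hρv
  have hco : 0 < ρ (r.act (x⁻¹ * u) (r.coα s)) := r.isRootAction.apply_pos _ s hxu ρ hρ
  have hinv : (u * cs.simple s * u⁻¹ * x)⁻¹ = x⁻¹ * (u * cs.simple s * u⁻¹) := by
    simp [mul_assoc]
  rw [hinv, act_mul_apply, act_conj, map_sub, map_smul, ← act_mul_apply, map_sub, map_smul,
    smul_eq_mul]
  linarith [mul_pos hβ hco]

end Realisation

/-- Fix `ρ ∈ 𝔥*` with `⟨ρ, α_s^∨⟩ > 0` for all `s ∈ S` and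
`ρ^∨ ∈ 𝔥` with `⟨α_s, ρ^∨⟩ > 0` for all `s ∈ S`.  If `x < w` in the Bruhat
order on `W`, then `⟨x(ρ), ρ^∨⟩ > ⟨w(ρ), ρ^∨⟩`, where `x(ρ) = ρ ∘ x⁻¹` is the
contragredient action of `x` on `𝔥*`. -/
theorem statement0 (cs : CoxeterSystem M W)
    (V : Type) [AddCommGroup V] [Module ℝ V] [FiniteDimensional ℝ V]
    (r : Realisation cs V)
    (ρ : Module.Dual ℝ V) (hρ : ∀ s : B, 0 < ρ (r.coα s))
    (ρv : V) (hρv : ∀ s : B, 0 < r.α s ρv)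
    (x w : W) (hxw : BruhatLT cs x w) :
    ρ (r.act w⁻¹ ρv) < ρ (r.act x⁻¹ ρv) := by
  unfold BruhatLT at hxw
  induction hxw with
  | single h =>
    obtain ⟨t, ht, rfl, hlt⟩ := h
    exact r.lt_of_reflection hρ hρv ht hlt
  | tail _ h ih =>
    obtain ⟨t, ht, rfl, hlt⟩ := h
    exact (r.lt_of_reflection hρ hρv ht hlt).trans ih
end
end

section
/- If y = y's for some s ∈ S with y' < y in the Bruhat order, then for every x ∈ W one has e_{x,y} = (1/x(α_s))·(e_{x,y'} + e_{xs,y'}) in Q. -/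
/-!
Common framework: a Coxeter system `(W, S)` (encoded via Mathlib's
`CoxeterSystem`, with `S = {simple s : s ∈ B}`), the Bruhat order on `W`, and
a realisation `(𝔥, 𝔥*, {α_s}, {α_s^∨})` of `(W, S)` over `ℝ`.
-/

noncomputable section

variable {B : Type} {W : Type} [Group W] {M : CoxeterMatrix B}

/-!
### The nil Hecke ring, pointwise

`Q_W = ⊕_x Q δ_x` is modelled pointwise: an element is a finitely supported
family of rational functions on `𝔥`, encoded as actual functions `V → ℝ`
(the divisions by roots being honest on the set `RegSet` of regular points).
Right multiplication by `D_s = (1/α_s)(δ_1 - δ_s)` uses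
`(f δ_x) · D_s = f · x(1/α_s) · (δ_x - δ_{x s})`, and
`D_{s_1 ⋯ s_m} = D_{s_1} ⋯ D_{s_m}` is the corresponding iterated product.
The equivariant multiplicity `e_{x, y}` (for a reduced word `ω` of `y`) is the
`δ_x`-coefficient of `D_y`.
-/

variable {V : Type} [AddCommGroup V] [Module ℝ V] [FiniteDimensional ℝ V]

/-- Right multiplication by `D_s` in (the pointwise model of) `Q_W`. -/
def rightD (cs : CoxeterSystem M W) (r : Realisation cs V)
    (c : W →₀ (V → ℝ)) (s : B) : W →₀ (V → ℝ) :=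
  c.sum fun x f =>
    Finsupp.single x (fun v => f v * (r.α s (r.act x⁻¹ v))⁻¹) -
      Finsupp.single (x * cs.simple s) (fun v => f v * (r.α s (r.act x⁻¹ v))⁻¹)

/-- `D_ω = D_{s_1} D_{s_2} ⋯ D_{s_m}` for a word `ω = s_1 ⋯ s_m`. -/
def nilD (cs : CoxeterSystem M W) (r : Realisation cs V) (l : List B) :
    W →₀ (V → ℝ) :=
  l.foldl (rightD cs r) (Finsupp.single 1 fun _ => (1 : ℝ))

/-- The equivariant multiplicity `e_{x, ω}`: the `δ_x`-coefficient of `D_ω`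
(for `ω` a reduced word of `y`, this is `e_{x,y}`), as a rational function
on `𝔥` (honest at regular points). -/
def eqMult (cs : CoxeterSystem M W) (r : Realisation cs V) (x : W)
    (l : List B) : V → ℝ :=
  nilD cs r l x

/-- The regular points of `𝔥`: those where no root `w(α_s)` vanishes.
(Two rational functions in `Q = R[1/Φ]` are equal iff they agree on this set.) -/
def RegSet (cs : CoxeterSystem M W) (r : Realisation cs V) : Set V :=
  {v | ∀ (w : W) (s : B), r.α s (r.act w v) ≠ 0}

/-- `prodForm ω v = ∏_{i=1}^{m} (α_{s_i}((s_1 ⋯ s_{i-1})⁻¹ v))⁻¹`: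
the value at `v` of `∏_{t ∈ L_T(y)} 1/α_t` for a reduced word `ω = s_1 ⋯ s_m`
of `y` (the `α_t` for `t` running over the left inversions `L_T(y)` being
precisely the roots `s_1 ⋯ s_{i-1}(α_{s_i})`). -/
def prodForm (cs : CoxeterSystem M W) (r : Realisation cs V) :
    List B → V → ℝ
  | [], _ => 1
  | s :: l, v => (r.α s v)⁻¹ * prodForm cs r l (r.act (cs.simple s)⁻¹ v)

theorem Realisation.α_act_simple (cs : CoxeterSystem M W) (r : Realisation cs V)
    (s : B) (v : V) : r.α s (r.act (cs.simple s) v) = -r.α s v := by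
  have h : r.α s (r.coα s) = 2 := by
    simp [r.pairing]
  rw [r.act_simple, map_sub, map_smul, h, smul_eq_mul]
  ring

theorem rightD_apply (cs : CoxeterSystem M W) (r : Realisation cs V)
    (c : W →₀ (V → ℝ)) (s : B) (x : W) (v : V) :
    rightD cs r c s x v =
      (r.α s (r.act x⁻¹ v))⁻¹ * (c x v + c (x * cs.simple s) v) := by
  induction c using Finsupp.induction_linear with
  | zero => simp [rightD]
  | add f g hf hg =>
    have hadd : rightD cs r (f + g) s = rightD cs r f s + rightD cs r g s := by
      classical
      unfold rightD
      refine Finsupp.sum_add_index' (fun y => ?_) fun y a b => ?_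
      · simp [← Pi.zero_def]
      · simp only [Pi.add_apply, add_mul, ← Pi.add_def, Finsupp.single_add]
        abel
    rw [hadd, Finsupp.add_apply, Pi.add_apply, hf, hg]
    simp only [Finsupp.add_apply, Pi.add_apply]
    ring
  | single y f =>
    classical
    have hs : rightD cs r (Finsupp.single y f) s =
        Finsupp.single y (fun v => f v * (r.α s (r.act y⁻¹ v))⁻¹) -
          Finsupp.single (y * cs.simple s) (fun v => f v * (r.α s (r.act y⁻¹ v))⁻¹) := by
      unfold rightD
      exact Finsupp.sum_single_index (by simp [← Pi.zero_def])
    have hne : cs.simple s ≠ 1 := fun h => by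
      have := cs.length_simple s
      rw [h, cs.length_one] at this
      omega
    rw [hs, Finsupp.sub_apply, Pi.sub_apply]
    by_cases hy : y = x
    · subst hy
      simp [hne, mul_comm]
    · by_cases hys : y = x * cs.simple s
      · subst hys
        simp [hne, mul_assoc, mul_inv_rev, r.α_act_simple, inv_neg, mul_comm]
      · have hxs : y * cs.simple s ≠ x := by
          rintro rfl
          simp at hys
        simp [hy, hys, hxs]

/-- If `y = y' s` for some `s ∈ S` with `y' < y` in the
Bruhat order, then for every `x ∈ W` one has
`e_{x,y} = (1 / x(α_s)) · (e_{x,y'} + e_{x s, y'})` in `Q`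
(as rational functions, i.e. at every regular point `v`; here `ω` is a
reduced word for `y'`, so that `ω ++ [s]` is a reduced word for `y`, and
`x(α_s)(v) = α_s(x⁻¹ v)`). -/
theorem statement2 (cs : CoxeterSystem M W)
    (V : Type) [AddCommGroup V] [Module ℝ V] [FiniteDimensional ℝ V]
    (r : Realisation cs V)
    (ω : List B) (s : B) (hred : cs.IsReduced ω)
    (hlt : BruhatLT cs (cs.wordProd ω) (cs.wordProd ω * cs.simple s)) :
    ∀ (x : W), ∀ v ∈ RegSet cs r,
      eqMult cs r x (ω ++ [s]) v =
        (r.α s (r.act x⁻¹ v))⁻¹ *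
          (eqMult cs r x ω v + eqMult cs r (x * cs.simple s) ω v) := by
  intro x v _
  simp only [eqMult, nilD, List.foldl_append, List.foldl_cons, List.foldl_nil]
  exact rightD_apply cs r _ s x v
end
end
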